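/- arXiv:1509.02611 — 8 statements merged into one kernel-verified Lean document; each statement's English description precedes it below -/
import Mathlib

section
/- Let τ ∈ ℂ, η ∈ ℝ with (τ + i v η)((τ + i v η)² + f²η²) ≠ 0 and (τ − i v η)((τ − i v η)² + f²η²) ≠ 0, and let ωʳ, ωˡ ∈ ℂ satisfy (ωʳ)² = zʳ(τ,η) and (ωˡ)² = zˡ(τ,η). Then the determinant of the 2×2 matrix β(τ,η)·(E₋ʳ | E₋ˡ) (the product of the 2×4 matrix β with the 4×2 matrix whose columns are E₋ʳ and E₋ˡ) equals c⁴·(τ + i v η)(τ − i v η)·[(τ + i v η)ωʳ − c((ωʳ)² − η²)]·[c((ωˡ)² − η²) − (τ − i v η)ωˡ]·(ωˡωʳ − η²)·(ωʳ + ωˡ). -/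
open Matrix

/-- On the dispersion relation `ω² = (a² + g) / c² + y`, the difference of the two nonzero
components of the rescaled stable eigenvector is a multiple of `c * (ω² - y) - a * ω`. -/
theorem stable_eigenvector_sub {c a g y ω : ℂ} (hc : c ≠ 0) (h : a * (a ^ 2 + g) ≠ 0)
    (hω : ω ^ 2 = (a ^ 2 + g) / c ^ 2 + y) :
    ((2 * a ^ 2 + g) / (2 * c * a) + c / 2 * (a * y) / (a ^ 2 + g) - ω) * (a * (a ^ 2 + g))
        - (c / 2 * (a * y) / (a ^ 2 + g) - g / (2 * c * a)) * (a * (a ^ 2 + g))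
      = c ^ 2 * (ω ^ 2 - y) * (c * (ω ^ 2 - y) - a * ω) := by
  have ha : a ≠ 0 := left_ne_zero_of_mul h
  have hS : a ^ 2 + g ≠ 0 := right_ne_zero_of_mul h
  rw [hω]
  field_simp
  ring

/-- On the dispersion relation `ω² = (a² + g) / c² + y`, the sum of the two nonzero
components of the rescaled stable eigenvector is a multiple of `a * ω - c * (ω² - y)`. -/
theorem stable_eigenvector_add {c a g y ω : ℂ} (hc : c ≠ 0) (h : a * (a ^ 2 + g) ≠ 0)
    (hω : ω ^ 2 = (a ^ 2 + g) / c ^ 2 + y) :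
    ((2 * a ^ 2 + g) / (2 * c * a) + c / 2 * (a * y) / (a ^ 2 + g) - ω) * (a * (a ^ 2 + g))
        + (c / 2 * (a * y) / (a ^ 2 + g) - g / (2 * c * a)) * (a * (a ^ 2 + g))
      = c * a * ω * (a * ω - c * (ω ^ 2 - y)) := by
  have ha : a ≠ 0 := left_ne_zero_of_mul h
  have hS : a ^ 2 + g ≠ 0 := right_ne_zero_of_mul h
  have hω' : c * a * ω * (a * ω - c * (ω ^ 2 - y))
      = c * a ^ 2 * ω ^ 2 - c ^ 2 * a * ω * (ω ^ 2 - y) := by ring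
  rw [hω', hω]
  field_simp
  ring

/-- The determinant of a `2 × 2` boundary matrix of vortex-sheet type applied to two
eigenvectors supported on complementary coordinates. -/
theorem det_vortexSheetBoundary_mul (p q x₁ x₂ y₁ y₂ : ℂ) :
    ((!![-1, 1, 1, -1; p, p, q, q] : Matrix (Fin 2) (Fin 4) ℂ)
        * !![x₁, 0; x₂, 0; 0, y₂; 0, y₁]).det
      = q * (x₂ - x₁) * (y₂ + y₁) - p * (x₂ + x₁) * (y₂ - y₁) := by
  simp [Matrix.det_fin_two]
  ring

/-- The Lopatinskii determinant factorization (5.1): the determinant of the 2×2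
matrix `β(τ,η)·(E₋ʳ | E₋ˡ)` equals
`c⁴(τ+ivη)(τ−ivη)[(τ+ivη)ωʳ − c((ωʳ)²−η²)][c((ωˡ)²−η²) − (τ−ivη)ωˡ](ωˡωʳ−η²)(ωʳ+ωˡ)`. -/
theorem elastic_vortex_sheet_lopatinskii_det
    (c v f : ℝ) (hc : 0 < c) (hv : 0 < v) (hf : 0 < f)
    (τ : ℂ) (η : ℝ)
    (hr : (τ + Complex.I * (v : ℂ) * (η : ℂ))
        * ((τ + Complex.I * (v : ℂ) * (η : ℂ)) ^ 2 + (f : ℂ) ^ 2 * (η : ℂ) ^ 2) ≠ 0)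
    (hl : (τ - Complex.I * (v : ℂ) * (η : ℂ))
        * ((τ - Complex.I * (v : ℂ) * (η : ℂ)) ^ 2 + (f : ℂ) ^ 2 * (η : ℂ) ^ 2) ≠ 0)
    (ωr ωl : ℂ)
    (hωr : ωr ^ 2 = ((τ + Complex.I * (v : ℂ) * (η : ℂ)) ^ 2 + (f : ℂ) ^ 2 * (η : ℂ) ^ 2)
        / (c : ℂ) ^ 2 + (η : ℂ) ^ 2)
    (hωl : ωl ^ 2 = ((τ - Complex.I * (v : ℂ) * (η : ℂ)) ^ 2 + (f : ℂ) ^ 2 * (η : ℂ) ^ 2)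
        / (c : ℂ) ^ 2 + (η : ℂ) ^ 2)
    (mr nr ml nl αr αl : ℂ)
    (hmr : mr = (c : ℂ) / 2 * ((τ + Complex.I * (v : ℂ) * (η : ℂ)) * (η : ℂ) ^ 2)
          / ((τ + Complex.I * (v : ℂ) * (η : ℂ)) ^ 2 + (f : ℂ) ^ 2 * (η : ℂ) ^ 2)
        - (f : ℂ) ^ 2 * (η : ℂ) ^ 2 / (2 * (c : ℂ) * (τ + Complex.I * (v : ℂ) * (η : ℂ))))
    (hnr : nr = (2 * (τ + Complex.I * (v : ℂ) * (η : ℂ)) ^ 2 + (f : ℂ) ^ 2 * (η : ℂ) ^ 2)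
          / (2 * (c : ℂ) * (τ + Complex.I * (v : ℂ) * (η : ℂ)))
        + (c : ℂ) / 2 * ((τ + Complex.I * (v : ℂ) * (η : ℂ)) * (η : ℂ) ^ 2)
          / ((τ + Complex.I * (v : ℂ) * (η : ℂ)) ^ 2 + (f : ℂ) ^ 2 * (η : ℂ) ^ 2))
    (hml : ml = (c : ℂ) / 2 * ((τ - Complex.I * (v : ℂ) * (η : ℂ)) * (η : ℂ) ^ 2)
          / ((τ - Complex.I * (v : ℂ) * (η : ℂ)) ^ 2 + (f : ℂ) ^ 2 * (η : ℂ) ^ 2)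
        - (f : ℂ) ^ 2 * (η : ℂ) ^ 2 / (2 * (c : ℂ) * (τ - Complex.I * (v : ℂ) * (η : ℂ))))
    (hnl : nl = (2 * (τ - Complex.I * (v : ℂ) * (η : ℂ)) ^ 2 + (f : ℂ) ^ 2 * (η : ℂ) ^ 2)
          / (2 * (c : ℂ) * (τ - Complex.I * (v : ℂ) * (η : ℂ)))
        + (c : ℂ) / 2 * ((τ - Complex.I * (v : ℂ) * (η : ℂ)) * (η : ℂ) ^ 2)
          / ((τ - Complex.I * (v : ℂ) * (η : ℂ)) ^ 2 + (f : ℂ) ^ 2 * (η : ℂ) ^ 2))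
    (hαr : αr = (τ + Complex.I * (v : ℂ) * (η : ℂ))
        * ((τ + Complex.I * (v : ℂ) * (η : ℂ)) ^ 2 + (f : ℂ) ^ 2 * (η : ℂ) ^ 2))
    (hαl : αl = (τ - Complex.I * (v : ℂ) * (η : ℂ))
        * ((τ - Complex.I * (v : ℂ) * (η : ℂ)) ^ 2 + (f : ℂ) ^ 2 * (η : ℂ) ^ 2))
    (β : Matrix (Fin 2) (Fin 4) ℂ)
    (hβ : β = !![-1, 1, 1, -1;
        -(c : ℂ) * (τ - Complex.I * (v : ℂ) * (η : ℂ)),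
        -(c : ℂ) * (τ - Complex.I * (v : ℂ) * (η : ℂ)),
        (c : ℂ) * (τ + Complex.I * (v : ℂ) * (η : ℂ)),
        (c : ℂ) * (τ + Complex.I * (v : ℂ) * (η : ℂ))])
    (E : Matrix (Fin 4) (Fin 2) ℂ)
    (hE : E = !![mr * αr, 0;
        (nr - ωr) * αr, 0;
        0, (nl - ωl) * αl;
        0, ml * αl]) :
    (β * E).det
      = (c : ℂ) ^ 4 * (τ + Complex.I * (v : ℂ) * (η : ℂ)) * (τ - Complex.I * (v : ℂ) * (η : ℂ))
        * ((τ + Complex.I * (v : ℂ) * (η : ℂ)) * ωr - (c : ℂ) * (ωr ^ 2 - (η : ℂ) ^ 2))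
        * ((c : ℂ) * (ωl ^ 2 - (η : ℂ) ^ 2) - (τ - Complex.I * (v : ℂ) * (η : ℂ)) * ωl)
        * (ωl * ωr - (η : ℂ) ^ 2) * (ωr + ωl) := by
  have hc' : (c : ℂ) ≠ 0 := by exact_mod_cast hc.ne'
  subst hβ hE hmr hnr hml hnl hαr hαl
  rw [det_vortexSheetBoundary_mul, stable_eigenvector_sub hc' hr hωr,
    stable_eigenvector_add hc' hr hωr, stable_eigenvector_sub hc' hl hωl,
    stable_eigenvector_add hc' hl hωl]
  ring
end

section
/- Assume v² > 2c² + f². Then V₁² > 0 and, with V₁ := √(V₁²), one has 0 < V₁ < v, (V₁ + v)² > f² + c², and (v − V₁)² > f² + c². -/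
/-- Inequality (5.9): in the supersonic zone `v² > 2c² + f²` one has `V₁² > 0`,
`0 < V₁ < v`, `(V₁ + v)² > f² + c²` and `(v − V₁)² > f² + c²`. -/
theorem elastic_vortex_sheet_ineq_5_9
    (c v f : ℝ) (hc : 0 < c) (hv : 0 < v) (hf : 0 < f)
    (h : v ^ 2 > 2 * c ^ 2 + f ^ 2)
    (V1sq : ℝ)
    (hV1sq : V1sq = v ^ 2 + f ^ 2 + c ^ 2 - Real.sqrt (c ^ 4 + 4 * (f ^ 2 + c ^ 2) * v ^ 2))
    (V1 : ℝ) (hV1 : V1 = Real.sqrt V1sq) :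
    0 < V1sq ∧ 0 < V1 ∧ V1 < v ∧
    (V1 + v) ^ 2 > f ^ 2 + c ^ 2 ∧ (v - V1) ^ 2 > f ^ 2 + c ^ 2 := by
  have hkpos : 0 < Real.sqrt (f ^ 2 + c ^ 2) := Real.sqrt_pos.2 (by positivity)
  have hksq : Real.sqrt (f ^ 2 + c ^ 2) ^ 2 = f ^ 2 + c ^ 2 := Real.sq_sqrt (by positivity)
  set k := Real.sqrt (f ^ 2 + c ^ 2)
  have hc2 : 0 < c ^ 2 := by positivity
  have hkv : k < v := lt_of_pow_lt_pow_left₀ 2 hv.le (by linarith)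
  have hpos : 0 < V1sq := by
    rw [hV1sq, sub_pos, Real.sqrt_lt' (by positivity)]
    nlinarith [mul_pos (show 0 < v ^ 2 - f ^ 2 - 2 * c ^ 2 by linarith)
      (show 0 < v ^ 2 - f ^ 2 by linarith)]
  have hroot : 2 * v * k < Real.sqrt (c ^ 4 + 4 * (f ^ 2 + c ^ 2) * v ^ 2) := by
    apply Real.lt_sqrt_of_sq_lt
    rw [← hksq]
    have : 0 < c ^ 4 := by positivity
    linear_combination this
  have hV1pos : 0 < V1 := hV1 ▸ Real.sqrt_pos.2 hpos
  have hV1lt : V1 < v - k := by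
    rw [hV1, Real.sqrt_lt' (sub_pos.2 hkv), hV1sq]
    linear_combination hroot - hksq
  refine ⟨hpos, hV1pos, by linarith, ?_, ?_⟩ <;> rw [gt_iff_lt, ← hksq]
  · exact pow_lt_pow_left₀ (by linarith) hkpos.le two_ne_zero
  · exact pow_lt_pow_left₀ (by linarith) hkpos.le two_ne_zero
end

section
/- Assume 0 < v² < f². Then V₁² > 0 and, with V₁ := √(V₁²), one has (V₁ + v)² < f² + c² and (V₁ − v)² < f² + c². -/
/-- Inequality (5.10): in the elasticity-generated subsonic zone `0 < v² < f²` one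
has `V₁² > 0`, `(V₁ + v)² < f² + c²` and `(V₁ − v)² < f² + c²`. -/
theorem elastic_vortex_sheet_ineq_5_10
    (c v f : ℝ) (hc : 0 < c) (hv : 0 < v) (hf : 0 < f)
    (h : v ^ 2 < f ^ 2)
    (V1sq : ℝ)
    (hV1sq : V1sq = v ^ 2 + f ^ 2 + c ^ 2 - Real.sqrt (c ^ 4 + 4 * (f ^ 2 + c ^ 2) * v ^ 2))
    (V1 : ℝ) (hV1 : V1 = Real.sqrt V1sq) :
    0 < V1sq ∧ (V1 + v) ^ 2 < f ^ 2 + c ^ 2 ∧ (V1 - v) ^ 2 < f ^ 2 + c ^ 2 := by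
  have hA : 0 < f ^ 2 + c ^ 2 := by positivity
  have hc2 : 0 < c ^ 2 := by positivity
  have hpos : 0 < V1sq := by
    have hS : √(c ^ 4 + 4 * (f ^ 2 + c ^ 2) * v ^ 2) < v ^ 2 + f ^ 2 + c ^ 2 := by
      rw [Real.sqrt_lt' (by positivity)]
      nlinarith [mul_pos (sub_pos.2 h) (sub_pos.2 h), mul_pos (sub_pos.2 h) hc2]
    linarith
  have hr : √(f ^ 2 + c ^ 2) ^ 2 = f ^ 2 + c ^ 2 := Real.sq_sqrt hA.le
  have hvr : v < √(f ^ 2 + c ^ 2) := Real.lt_sqrt_of_sq_lt (by linarith)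
  have hV1r : V1 < √(f ^ 2 + c ^ 2) - v := by
    have hS : 2 * v * √(f ^ 2 + c ^ 2) < √(c ^ 4 + 4 * (f ^ 2 + c ^ 2) * v ^ 2) := by
      apply Real.lt_sqrt_of_sq_lt
      rw [mul_pow, hr]
      nlinarith [pow_pos hc 4]
    rw [hV1, Real.sqrt_lt' (sub_pos.2 hvr)]
    nlinarith
  have hV1nn : 0 ≤ V1 := hV1 ▸ Real.sqrt_nonneg _
  have hplus : (V1 + v) ^ 2 < f ^ 2 + c ^ 2 := by
    rw [← hr]
    exact pow_lt_pow_left₀ (by linarith) (by positivity) two_ne_zero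
  exact ⟨hpos, hplus, by nlinarith [mul_nonneg hV1nn hv.le]⟩
end

section
/- Let v, c, f > 0 and suppose V₁² ≥ 0, where V₁² := v² + f² + c² − √(c⁴ + 4(f² + c²)v²). Then V₁² = v² if and only if v² = f²(2c² + f²)/(4(f² + c²)). Moreover f²(2c² + f²)/(4(f² + c²)) < f². -/
/-- The exceptional subsonic states of Lemma 5.1, Case 3: when `V₁² ≥ 0`, the
coincidence `V₁² = v²` happens exactly when `v² = f²(2c² + f²)/(4(f² + c²))`;
moreover this threshold value is strictly less than `f²`. -/
theorem elastic_vortex_sheet_case3_states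
    (c v f : ℝ) (hc : 0 < c) (hv : 0 < v) (hf : 0 < f)
    (V1sq : ℝ)
    (hV1sq : V1sq = v ^ 2 + f ^ 2 + c ^ 2 - Real.sqrt (c ^ 4 + 4 * (f ^ 2 + c ^ 2) * v ^ 2))
    (hpos : 0 ≤ V1sq) :
    (V1sq = v ^ 2 ↔ v ^ 2 = f ^ 2 * (2 * c ^ 2 + f ^ 2) / (4 * (f ^ 2 + c ^ 2))) ∧
    f ^ 2 * (2 * c ^ 2 + f ^ 2) / (4 * (f ^ 2 + c ^ 2)) < f ^ 2 := by
  have h_den : 0 < 4 * (f ^ 2 + c ^ 2) := by positivity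
  constructor
  · have h_sqrt : V1sq = v ^ 2 ↔
        Real.sqrt (c ^ 4 + 4 * (f ^ 2 + c ^ 2) * v ^ 2) = f ^ 2 + c ^ 2 := by
      constructor <;> intro h <;> linarith
    rw [h_sqrt, Real.sqrt_eq_iff_mul_self_eq (by positivity) (by positivity), eq_div_iff h_den.ne']
    constructor <;> intro h <;> linarith
  · rw [div_lt_iff₀ h_den]
    have h_f : 0 < f ^ 2 * f ^ 2 := by positivity
    have h_fc : 0 < f ^ 2 * c ^ 2 := by positivity
    linarith
end

section
/- Let v, c, f > 0 and assume v² > 2c² + f² or v² < f². Then 0 < V₁² < V₂², and the quartic polynomial q(V) = ((V + v)² − f² − c²)·((V − v)² − f² − c²) − c⁴ has exactly four roots, namely the pairwise distinct real numbers √(V₁²), −√(V₁²), √(V₂²), −√(V₂²), and each of these roots is simple. -/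
open Polynomial

/-- Simplicity of the roots `±V₁, ±V₂` of the quartic
`q(V) = ((V + v)² − f² − c²)((V − v)² − f² − c²) − c⁴`
in the stable Cases 1 and 2 of Lemma 5.1 (`v² > 2c² + f²` or `v² < f²`):
`0 < V₁² < V₂²`, the four numbers `±√V₁², ±√V₂²` are pairwise distinct, they are
exactly the roots of `q`, and each is a simple root. -/
theorem elastic_vortex_sheet_simple_roots
    (c v f : ℝ) (hc : 0 < c) (hv : 0 < v) (hf : 0 < f)
    (h : v ^ 2 > 2 * c ^ 2 + f ^ 2 ∨ v ^ 2 < f ^ 2)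
    (V1sq V2sq : ℝ)
    (hV1sq : V1sq = v ^ 2 + f ^ 2 + c ^ 2 - Real.sqrt (c ^ 4 + 4 * (f ^ 2 + c ^ 2) * v ^ 2))
    (hV2sq : V2sq = v ^ 2 + f ^ 2 + c ^ 2 + Real.sqrt (c ^ 4 + 4 * (f ^ 2 + c ^ 2) * v ^ 2))
    (a b : ℝ) (ha : a = Real.sqrt V1sq) (hb : b = Real.sqrt V2sq)
    (q : Polynomial ℝ)
    (hq : q = ((X + C v) ^ 2 - C (f ^ 2) - C (c ^ 2))
        * ((X - C v) ^ 2 - C (f ^ 2) - C (c ^ 2)) - C (c ^ 4)) :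
    (0 < V1sq ∧ V1sq < V2sq) ∧
    (a ≠ -a ∧ a ≠ b ∧ a ≠ -b ∧ -a ≠ b ∧ -a ≠ -b ∧ b ≠ -b) ∧
    q.roots = {a, -a, b, -b} ∧
    (rootMultiplicity a q = 1 ∧ rootMultiplicity (-a) q = 1 ∧
      rootMultiplicity b q = 1 ∧ rootMultiplicity (-b) q = 1) := by
  have hD : 0 < c ^ 4 + 4 * (f ^ 2 + c ^ 2) * v ^ 2 := by positivity
  have hs_sq := Real.sq_sqrt hD.le
  have hs_pos := Real.sqrt_pos.mpr hD
  generalize Real.sqrt (c ^ 4 + 4 * (f ^ 2 + c ^ 2) * v ^ 2) = s at *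
  have hlt : V1sq < V2sq := by linarith
  have h2 : 0 < V2sq := by rw [hV2sq]; positivity
  have hprod : V1sq * V2sq = (v ^ 2 - f ^ 2 - 2 * c ^ 2) * (v ^ 2 - f ^ 2) := by
    rw [hV1sq, hV2sq]
    linear_combination -hs_sq
  have hprod_pos : 0 < V1sq * V2sq := by
    rw [hprod]
    rcases h with h | h
    · exact mul_pos (by linarith) (by nlinarith)
    · exact mul_pos_of_neg_of_neg (by nlinarith) (by linarith)
  have h1 : 0 < V1sq := pos_of_mul_pos_left hprod_pos h2.le
  have ha_pos : 0 < a := ha ▸ Real.sqrt_pos.mpr h1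
  have hab : a < b := by rw [ha, hb]; exact Real.sqrt_lt_sqrt h1.le hlt
  have ha_sq : a ^ 2 = V1sq := by rw [ha, Real.sq_sqrt h1.le]
  have hb_sq : b ^ 2 = V2sq := by rw [hb, Real.sq_sqrt h2.le]
  have hdistinct : a ≠ -a ∧ a ≠ b ∧ a ≠ -b ∧ -a ≠ b ∧ -a ≠ -b ∧ b ≠ -b := by
    refine ⟨?_, ?_, ?_, ?_, ?_, ?_⟩ <;> intro h <;> linarith
  have hfactor : q = (Multiset.map (fun r => X - C r) {a, -a, b, -b}).prod := by
    refine Polynomial.funext fun x => ?_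
    simp only [hq, Multiset.insert_eq_cons, Multiset.map_cons, Multiset.map_singleton,
      Multiset.prod_cons, Multiset.prod_singleton, eval_mul, eval_sub, eval_add, eval_pow,
      eval_X, eval_C]
    have hsum : a ^ 2 + b ^ 2 = 2 * (v ^ 2 + f ^ 2 + c ^ 2) := by
      rw [ha_sq, hb_sq]; linarith
    have hmul : a ^ 2 * b ^ 2 = (v ^ 2 - f ^ 2 - 2 * c ^ 2) * (v ^ 2 - f ^ 2) := by
      rw [ha_sq, hb_sq, hprod]
    linear_combination x ^ 2 * hsum - hmul
  have hroots : q.roots = {a, -a, b, -b} := by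
    rw [hfactor, roots_multiset_prod_X_sub_C]
  obtain ⟨d1, d2, d3, d4, d5, d6⟩ := hdistinct
  refine ⟨⟨h1, hlt⟩, ⟨d1, d2, d3, d4, d5, d6⟩, hroots, ?_⟩
  have hnodup : q.roots.Nodup := by
    rw [hroots]
    simp only [Multiset.insert_eq_cons, Multiset.nodup_cons, Multiset.mem_cons,
      Multiset.mem_singleton, Multiset.nodup_singleton, not_or]
    exact ⟨⟨d1, d2, d3⟩, ⟨d4, d5⟩, d6, trivial⟩
  simp only [← count_roots]
  refine ⟨?_, ?_, ?_, ?_⟩ <;>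
    exact Multiset.count_eq_one_of_mem hnodup (by simp [hroots])
end

section
/- Let τ ∈ ℂ, η ∈ ℝ with (τ + i v η)((τ + i v η)² + f²η²) ≠ 0 and (τ − i v η)((τ − i v η)² + f²η²) ≠ 0. Then (nʳ)² − (mʳ)² = zʳ(τ, η) and (nˡ)² − (mˡ)² = zˡ(τ, η), and consequently the characteristic polynomial of the 4×4 matrix A(τ, η) equals (X² − zʳ(τ, η))·(X² − zˡ(τ, η)). -/
open Matrix Polynomial

/-- With `a = s ^ 2 + g`, the two factors of `n ^ 2 - m ^ 2` are `n - m = a / (c * s)` and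
`n + m = s / c + c * s * h / a`. -/
theorem dispersion_sq_sub_sq {K : Type*} [Field K] [NeZero (2 : K)] {c s g h : K}
    (hc : c ≠ 0) (hs : s * (s ^ 2 + g) ≠ 0) :
    ((2 * s ^ 2 + g) / (2 * c * s) + c / 2 * (s * h) / (s ^ 2 + g)) ^ 2
      - (c / 2 * (s * h) / (s ^ 2 + g) - g / (2 * c * s)) ^ 2 = (s ^ 2 + g) / c ^ 2 + h := by
  obtain ⟨hs, ha⟩ := mul_ne_zero_iff.mp hs
  have h2 : (2 : K) ≠ 0 := two_ne_zero
  field_simp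
  ring

/-- The characteristic polynomial of a block-diagonal matrix with two traceless blocks. -/
theorem charpoly_traceless_blocks {R : Type*} [CommRing R] (m n p q : R) :
    (!![n, -m, 0, 0; m, -n, 0, 0; 0, 0, -q, p; 0, 0, -p, q] : Matrix (Fin 4) (Fin 4) R).charpoly
      = (X ^ 2 - C (n ^ 2 - m ^ 2)) * (X ^ 2 - C (q ^ 2 - p ^ 2)) := by
  simp [Matrix.charpoly, Matrix.charmatrix, Matrix.det_succ_row_zero, Fin.sum_univ_succ,
    Fin.succAbove]
  ring

/-- Dispersion relation (4.3) of Lemma 4.1: `(nʳ)² − (mʳ)² = zʳ`, `(nˡ)² − (mˡ)² = zˡ`,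
and the characteristic polynomial of the 4×4 matrix `A(τ,η)` equals
`(X² − zʳ)(X² − zˡ)`; i.e. the eigenvalues of `A` are `±ωʳ, ±ωˡ` with `(ω^{r,l})² = z^{r,l}`. -/
theorem elastic_vortex_sheet_charpoly
    (c v f : ℝ) (hc : 0 < c) (hv : 0 < v) (hf : 0 < f)
    (τ : ℂ) (η : ℝ)
    (hr : (τ + Complex.I * (v : ℂ) * (η : ℂ))
        * ((τ + Complex.I * (v : ℂ) * (η : ℂ)) ^ 2 + (f : ℂ) ^ 2 * (η : ℂ) ^ 2) ≠ 0)
    (hl : (τ - Complex.I * (v : ℂ) * (η : ℂ))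
        * ((τ - Complex.I * (v : ℂ) * (η : ℂ)) ^ 2 + (f : ℂ) ^ 2 * (η : ℂ) ^ 2) ≠ 0)
    (zr zl : ℂ)
    (hzr : zr = ((τ + Complex.I * (v : ℂ) * (η : ℂ)) ^ 2 + (f : ℂ) ^ 2 * (η : ℂ) ^ 2)
        / (c : ℂ) ^ 2 + (η : ℂ) ^ 2)
    (hzl : zl = ((τ - Complex.I * (v : ℂ) * (η : ℂ)) ^ 2 + (f : ℂ) ^ 2 * (η : ℂ) ^ 2)
        / (c : ℂ) ^ 2 + (η : ℂ) ^ 2)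
    (mr nr ml nl : ℂ)
    (hmr : mr = (c : ℂ) / 2 * ((τ + Complex.I * (v : ℂ) * (η : ℂ)) * (η : ℂ) ^ 2)
          / ((τ + Complex.I * (v : ℂ) * (η : ℂ)) ^ 2 + (f : ℂ) ^ 2 * (η : ℂ) ^ 2)
        - (f : ℂ) ^ 2 * (η : ℂ) ^ 2 / (2 * (c : ℂ) * (τ + Complex.I * (v : ℂ) * (η : ℂ))))
    (hnr : nr = (2 * (τ + Complex.I * (v : ℂ) * (η : ℂ)) ^ 2 + (f : ℂ) ^ 2 * (η : ℂ) ^ 2)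
          / (2 * (c : ℂ) * (τ + Complex.I * (v : ℂ) * (η : ℂ)))
        + (c : ℂ) / 2 * ((τ + Complex.I * (v : ℂ) * (η : ℂ)) * (η : ℂ) ^ 2)
          / ((τ + Complex.I * (v : ℂ) * (η : ℂ)) ^ 2 + (f : ℂ) ^ 2 * (η : ℂ) ^ 2))
    (hml : ml = (c : ℂ) / 2 * ((τ - Complex.I * (v : ℂ) * (η : ℂ)) * (η : ℂ) ^ 2)
          / ((τ - Complex.I * (v : ℂ) * (η : ℂ)) ^ 2 + (f : ℂ) ^ 2 * (η : ℂ) ^ 2)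
        - (f : ℂ) ^ 2 * (η : ℂ) ^ 2 / (2 * (c : ℂ) * (τ - Complex.I * (v : ℂ) * (η : ℂ))))
    (hnl : nl = (2 * (τ - Complex.I * (v : ℂ) * (η : ℂ)) ^ 2 + (f : ℂ) ^ 2 * (η : ℂ) ^ 2)
          / (2 * (c : ℂ) * (τ - Complex.I * (v : ℂ) * (η : ℂ)))
        + (c : ℂ) / 2 * ((τ - Complex.I * (v : ℂ) * (η : ℂ)) * (η : ℂ) ^ 2)
          / ((τ - Complex.I * (v : ℂ) * (η : ℂ)) ^ 2 + (f : ℂ) ^ 2 * (η : ℂ) ^ 2))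
    (A : Matrix (Fin 4) (Fin 4) ℂ)
    (hA : A = !![nr, -mr, 0, 0;
        mr, -nr, 0, 0;
        0, 0, -nl, ml;
        0, 0, -ml, nl]) :
    nr ^ 2 - mr ^ 2 = zr ∧ nl ^ 2 - ml ^ 2 = zl ∧
    A.charpoly = (X ^ 2 - C zr) * (X ^ 2 - C zl) := by
  have hc' : (c : ℂ) ≠ 0 := Complex.ofReal_ne_zero.mpr hc.ne'
  have hzr' : nr ^ 2 - mr ^ 2 = zr := by
    rw [hnr, hmr, hzr]
    exact dispersion_sq_sub_sq hc' hr
  have hzl' : nl ^ 2 - ml ^ 2 = zl := by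
    rw [hnl, hml, hzl]
    exact dispersion_sq_sub_sq hc' hl
  refine ⟨hzr', hzl', ?_⟩
  rw [hA, charpoly_traceless_blocks, hzr', hzl']
end

section
/- Let τ ∈ ℂ, η ∈ ℝ with Re τ > 0. Then zʳ(τ, η) is not a nonpositive real number, and consequently there exists a unique ωʳ ∈ ℂ with (ωʳ)² = zʳ(τ, η) and Re ωʳ < 0. The same holds for zˡ(τ, η). -/
theorem Complex.sq_add_ofReal_mem_slitPlane {s : ℂ} (hs : 0 < s.re) {r : ℝ} (hr : 0 ≤ r) :
    s ^ 2 + (r : ℂ) ∈ Complex.slitPlane := by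
  rw [Complex.mem_slitPlane_iff]
  by_cases h : s.im = 0
  · left
    simp only [pow_two, Complex.add_re, Complex.mul_re, Complex.ofReal_re, h]
    nlinarith [mul_pos hs hs]
  · right
    simp only [pow_two, Complex.add_im, Complex.mul_im, Complex.ofReal_im]
    have := mul_ne_zero hs.ne' h
    contrapose! this
    linarith

theorem Complex.not_im_eq_zero_and_re_nonpos_of_mem_slitPlane {z : ℂ}
    (hz : z ∈ Complex.slitPlane) : ¬(z.im = 0 ∧ z.re ≤ 0) := by
  rintro ⟨him, hre⟩
  exact (Complex.mem_slitPlane_iff.mp hz).elim hre.not_gt (fun h => h him)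

theorem Complex.existsUnique_sq_eq_re_neg {z : ℂ} (hz : z ∈ Complex.slitPlane) :
    ∃! ω : ℂ, ω ^ 2 = z ∧ ω.re < 0 := by
  obtain ⟨w, rfl⟩ := IsAlgClosed.exists_pow_nat_eq z two_pos
  have hw : w.re ≠ 0 := fun h =>
    Complex.not_im_eq_zero_and_re_nonpos_of_mem_slitPlane hz
      (by simp [pow_two, h, mul_self_nonneg])
  have unique {a b : ℂ} (hab : a ^ 2 = b ^ 2) (ha : a.re < 0) (hb : b.re < 0) : a = b := by
    rcases sq_eq_sq_iff_eq_or_eq_neg.mp hab with h | h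
    · exact h
    · rw [h, Complex.neg_re] at ha
      linarith
  rcases hw.lt_or_gt with hneg | hpos
  · exact ⟨w, ⟨rfl, hneg⟩, fun y hy => unique hy.1 hy.2 hneg⟩
  · have hneg : (-w).re < 0 := by simpa using hpos
    exact ⟨-w, ⟨neg_sq w, hneg⟩, fun y hy => unique (hy.1.trans (neg_sq w).symm) hy.2 hneg⟩

theorem Complex.dispersion_mem_slitPlane {c : ℝ} (hc : 0 < c) (f η : ℝ) {s : ℂ} (hs : 0 < s.re) :
    (s ^ 2 + (f : ℂ) ^ 2 * (η : ℂ) ^ 2) / (c : ℂ) ^ 2 + (η : ℂ) ^ 2 ∈ Complex.slitPlane := by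
  have hsc : 0 < (s / (c : ℂ)).re := by
    rw [Complex.div_ofReal_re]
    exact div_pos hs hc
  have hr : 0 ≤ f ^ 2 * η ^ 2 / c ^ 2 + η ^ 2 := by positivity
  convert Complex.sq_add_ofReal_mem_slitPlane hsc hr using 1
  push_cast
  ring

/-- The Hersh-type statement of Lemma 4.1: for `Re τ > 0` the dispersion values
`zʳ(τ,η)` and `zˡ(τ,η)` are not nonpositive reals, and hence each admits a unique
square root with negative real part. -/
theorem elastic_vortex_sheet_hersh
    (c v f : ℝ) (hc : 0 < c) (hv : 0 < v) (hf : 0 < f)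
    (τ : ℂ) (η : ℝ) (hτ : 0 < τ.re)
    (zr zl : ℂ)
    (hzr : zr = ((τ + Complex.I * (v : ℂ) * (η : ℂ)) ^ 2 + (f : ℂ) ^ 2 * (η : ℂ) ^ 2)
        / (c : ℂ) ^ 2 + (η : ℂ) ^ 2)
    (hzl : zl = ((τ - Complex.I * (v : ℂ) * (η : ℂ)) ^ 2 + (f : ℂ) ^ 2 * (η : ℂ) ^ 2)
        / (c : ℂ) ^ 2 + (η : ℂ) ^ 2) :
    ¬(zr.im = 0 ∧ zr.re ≤ 0) ∧ (∃! ω : ℂ, ω ^ 2 = zr ∧ ω.re < 0) ∧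
    ¬(zl.im = 0 ∧ zl.re ≤ 0) ∧ (∃! ω : ℂ, ω ^ 2 = zl ∧ ω.re < 0) := by
  have hr : zr ∈ Complex.slitPlane :=
    hzr ▸ Complex.dispersion_mem_slitPlane hc f η (by simpa using hτ)
  have hl : zl ∈ Complex.slitPlane :=
    hzl ▸ Complex.dispersion_mem_slitPlane hc f η (by simpa using hτ)
  exact ⟨Complex.not_im_eq_zero_and_re_nonpos_of_mem_slitPlane hr,
    Complex.existsUnique_sq_eq_re_neg hr,
    Complex.not_im_eq_zero_and_re_nonpos_of_mem_slitPlane hl,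
    Complex.existsUnique_sq_eq_re_neg hl⟩
end

section
/- Let τ ∈ ℂ, η ∈ ℝ with (τ + i v η)((τ + i v η)² + f²η²) ≠ 0 and (τ − i v η)((τ − i v η)² + f²η²) ≠ 0, and let ωʳ, ωˡ ∈ ℂ satisfy (ωʳ)² = (nʳ)² − (mʳ)² and (ωˡ)² = (nˡ)² − (mˡ)². Then the 4×4 matrix A(τ, η) satisfies: A·E₋ʳ = ωʳ·E₋ʳ, A·E₊ʳ = −ωʳ·E₊ʳ, A·E₋ˡ = ωˡ·E₋ˡ, and A·E₊ˡ = −ωˡ·E₊ˡ, where E₋ʳ = (mʳαʳ, (nʳ − ωʳ)αʳ, 0, 0)ᵀ, E₊ʳ = (mʳαʳ, (nʳ + ωʳ)αʳ, 0, 0)ᵀ, E₋ˡ = (0, 0, (nˡ − ωˡ)αˡ, mˡαˡ)ᵀ, and E₊ˡ = (0, 0, (nˡ + ωˡ)αˡ, mˡαˡ)ᵀ. -/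
open Matrix

/-- The eigenvector statement (4.4) of Lemma 4.1: `E₋ʳ, E₊ʳ, E₋ˡ, E₊ˡ` are
eigenvectors of `A(τ,η)` for the eigenvalues `ωʳ, −ωʳ, ωˡ, −ωˡ` respectively. -/
theorem elastic_vortex_sheet_eigenvectors
    (c v f : ℝ) (hc : 0 < c) (hv : 0 < v) (hf : 0 < f)
    (τ : ℂ) (η : ℝ)
    (hr : (τ + Complex.I * (v : ℂ) * (η : ℂ))
        * ((τ + Complex.I * (v : ℂ) * (η : ℂ)) ^ 2 + (f : ℂ) ^ 2 * (η : ℂ) ^ 2) ≠ 0)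
    (hl : (τ - Complex.I * (v : ℂ) * (η : ℂ))
        * ((τ - Complex.I * (v : ℂ) * (η : ℂ)) ^ 2 + (f : ℂ) ^ 2 * (η : ℂ) ^ 2) ≠ 0)
    (mr nr ml nl αr αl : ℂ)
    (hmr : mr = (c : ℂ) / 2 * ((τ + Complex.I * (v : ℂ) * (η : ℂ)) * (η : ℂ) ^ 2)
          / ((τ + Complex.I * (v : ℂ) * (η : ℂ)) ^ 2 + (f : ℂ) ^ 2 * (η : ℂ) ^ 2)
        - (f : ℂ) ^ 2 * (η : ℂ) ^ 2 / (2 * (c : ℂ) * (τ + Complex.I * (v : ℂ) * (η : ℂ))))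
    (hnr : nr = (2 * (τ + Complex.I * (v : ℂ) * (η : ℂ)) ^ 2 + (f : ℂ) ^ 2 * (η : ℂ) ^ 2)
          / (2 * (c : ℂ) * (τ + Complex.I * (v : ℂ) * (η : ℂ)))
        + (c : ℂ) / 2 * ((τ + Complex.I * (v : ℂ) * (η : ℂ)) * (η : ℂ) ^ 2)
          / ((τ + Complex.I * (v : ℂ) * (η : ℂ)) ^ 2 + (f : ℂ) ^ 2 * (η : ℂ) ^ 2))
    (hml : ml = (c : ℂ) / 2 * ((τ - Complex.I * (v : ℂ) * (η : ℂ)) * (η : ℂ) ^ 2)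
          / ((τ - Complex.I * (v : ℂ) * (η : ℂ)) ^ 2 + (f : ℂ) ^ 2 * (η : ℂ) ^ 2)
        - (f : ℂ) ^ 2 * (η : ℂ) ^ 2 / (2 * (c : ℂ) * (τ - Complex.I * (v : ℂ) * (η : ℂ))))
    (hnl : nl = (2 * (τ - Complex.I * (v : ℂ) * (η : ℂ)) ^ 2 + (f : ℂ) ^ 2 * (η : ℂ) ^ 2)
          / (2 * (c : ℂ) * (τ - Complex.I * (v : ℂ) * (η : ℂ)))
        + (c : ℂ) / 2 * ((τ - Complex.I * (v : ℂ) * (η : ℂ)) * (η : ℂ) ^ 2)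
          / ((τ - Complex.I * (v : ℂ) * (η : ℂ)) ^ 2 + (f : ℂ) ^ 2 * (η : ℂ) ^ 2))
    (hαr : αr = (τ + Complex.I * (v : ℂ) * (η : ℂ))
        * ((τ + Complex.I * (v : ℂ) * (η : ℂ)) ^ 2 + (f : ℂ) ^ 2 * (η : ℂ) ^ 2))
    (hαl : αl = (τ - Complex.I * (v : ℂ) * (η : ℂ))
        * ((τ - Complex.I * (v : ℂ) * (η : ℂ)) ^ 2 + (f : ℂ) ^ 2 * (η : ℂ) ^ 2))
    (ωr ωl : ℂ)
    (hωr : ωr ^ 2 = nr ^ 2 - mr ^ 2) (hωl : ωl ^ 2 = nl ^ 2 - ml ^ 2)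
    (A : Matrix (Fin 4) (Fin 4) ℂ)
    (hA : A = !![nr, -mr, 0, 0;
        mr, -nr, 0, 0;
        0, 0, -nl, ml;
        0, 0, -ml, nl]) :
    A.mulVec ![mr * αr, (nr - ωr) * αr, 0, 0] = ωr • ![mr * αr, (nr - ωr) * αr, 0, 0] ∧
    A.mulVec ![mr * αr, (nr + ωr) * αr, 0, 0] = (-ωr) • ![mr * αr, (nr + ωr) * αr, 0, 0] ∧
    A.mulVec ![0, 0, (nl - ωl) * αl, ml * αl] = ωl • ![0, 0, (nl - ωl) * αl, ml * αl] ∧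
    A.mulVec ![0, 0, (nl + ωl) * αl, ml * αl] = (-ωl) • ![0, 0, (nl + ωl) * αl, ml * αl] := by
  subst hA
  refine ⟨?_, ?_, ?_, ?_⟩ <;> ext i <;> fin_cases i <;>
    simp [Matrix.mulVec, dotProduct, Fin.sum_univ_succ]
  · ring
  · linear_combination αr * hωr
  · ring
  · linear_combination αr * hωr
  · linear_combination αl * hωl
  · ring
  · linear_combination αl * hωl
  · ring
end
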